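/- Let G be an infinite locally finite connected graph and D a finite connected graph. Fix a vertex d₀ of D and identify G with its copy G × {d₀} inside the Cartesian product G □ D. Then this copy of G is a faithful subgraph of G □ D. -/

import Mathlib

namespace IGraph

open SimpleGraph

universe u w

variable {V : Type u} {W : Type w}

/-- `G` is locally finite: every vertex has finite degree. -/
def LocFin (G : SimpleGraph V) : Prop := ∀ v : V, (G.neighborSet v).Finite

/-- A ray of `G`: a one-way infinite path, given by an injective sequence of
successively adjacent vertices. -/
def IsRay (G : SimpleGraph V) (R : ℕ → V) : Prop :=
  Function.Injective R ∧ ∀ n : ℕ, G.Adj (R n) (R (n + 1))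

/-- `G − S`, kept on the same vertex type (removed vertices become isolated). -/
def del (G : SimpleGraph V) (S : Set V) : SimpleGraph V where
  Adj a b := G.Adj a b ∧ a ∉ S ∧ b ∉ S
  symm := ⟨fun a b h => ⟨h.1.symm, h.2.2, h.2.1⟩⟩
  loopless := ⟨fun a h => G.loopless.irrefl a h.1⟩

/-- Two rays are equivalent in `G` if for every finite `S ⊆ V(G)` some component of
`G − S` contains a tail of both. -/
def RayEquiv (G : SimpleGraph V) (R₁ R₂ : ℕ → V) : Prop :=
  ∀ S : Set V, S.Finite →
    ∃ m n : ℕ, (∀ i, m ≤ i → R₁ i ∉ S) ∧ (∀ j, n ≤ j → R₂ j ∉ S) ∧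
      (del G S).Reachable (R₁ m) (R₂ n)

/-- `F` is a faithful subgraph of `G` (both presented on the same vertex type):
(1) every end of `G` contains a ray of `F`, and (2) two rays of `F` are equivalent in `F`
iff they are equivalent in `G`. -/
def Faithful (F G : SimpleGraph V) : Prop :=
  (∀ R : ℕ → V, IsRay G R → ∃ R' : ℕ → V, IsRay F R' ∧ RayEquiv G R R') ∧
  ∀ R₁ R₂ : ℕ → V, IsRay F R₁ → IsRay F R₂ → (RayEquiv F R₁ R₂ ↔ RayEquiv G R₁ R₂)

/-- `N_G(X)`: vertices outside `X` with a neighbor in `X`. -/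
def NSet (G : SimpleGraph V) (X : Set V) : Set V := {y | y ∉ X ∧ ∃ x ∈ X, G.Adj x y}

/-- `Z_G(X)`: vertices of `X` with a neighbor outside `X`. -/
def ZSet (G : SimpleGraph V) (X : Set V) : Set V := {x | x ∈ X ∧ ∃ y, y ∉ X ∧ G.Adj x y}

/-- The vertex set of the component of `G − S` containing `v`. -/
def compOf (G : SimpleGraph V) (S : Set V) (v : V) : Set V := {x | (del G S).Reachable v x}

/-- The degree of the end of `G` represented by the ray `R`: the supremum of the numbers of
pairwise vertex-disjoint rays equivalent to `R`. -/
noncomputable def endDegree (G : SimpleGraph V) (R : ℕ → V) : ℕ∞ :=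
  ⨆ n ∈ {n : ℕ | ∃ f : Fin n → ℕ → V,
      (∀ i, IsRay G (f i) ∧ RayEquiv G (f i) R) ∧
      ∀ i j, i ≠ j → Disjoint (Set.range (f i)) (Set.range (f j))}, (n : ℕ∞)

/-- `H` is `k`-connected: `|V(H)| > k` and removing fewer than `k` vertices leaves a
connected graph. -/
def IsKConn (k : ℕ) (H : SimpleGraph W) : Prop :=
  (k : Cardinal) < Cardinal.mk W ∧
    ∀ X : Set W, X.Finite → X.ncard < k → (H.induce Xᶜ).Connected

/-- Every vertex has degree at most 3. -/
def Subcubic (G : SimpleGraph V) : Prop :=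
  ∀ v : V, (G.neighborSet v).Finite ∧ (G.neighborSet v).ncard ≤ 3

/-- Every vertex has degree exactly 3. -/
def Cubic (G : SimpleGraph V) : Prop := ∀ v : V, (G.neighborSet v).ncard = 3

/-- `S` is 3-connected in `G`: every two vertices of `S` are joined by three pairwise
internally disjoint paths of `G`. -/
def ThreeConnIn (G : SimpleGraph V) (S : Set V) : Prop :=
  ∀ u v : V, u ∈ S → v ∈ S → u ≠ v →
    ∃ p₁ p₂ p₃ : G.Path u v,
      p₁ ≠ p₂ ∧ p₁ ≠ p₃ ∧ p₂ ≠ p₃ ∧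
      (∀ x, x ∈ (p₁ : G.Walk u v).support → x ∈ (p₂ : G.Walk u v).support → x = u ∨ x = v) ∧
      (∀ x, x ∈ (p₁ : G.Walk u v).support → x ∈ (p₃ : G.Walk u v).support → x = u ∨ x = v) ∧
      (∀ x, x ∈ (p₂ : G.Walk u v).support → x ∈ (p₃ : G.Walk u v).support → x = u ∨ x = v)

/-- A subgraph which is a (finite) cycle: finite, nonempty, connected and 2-regular. -/
def IsCycleSub {G : SimpleGraph W} (C : G.Subgraph) : Prop :=
  C.verts.Finite ∧ C.verts.Nonempty ∧ C.Connected ∧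
    ∀ v ∈ C.verts, (C.neighborSet v).ncard = 2

/-- A cactus: a connected subcubic graph whose cycles are pairwise vertex-disjoint and whose
edges decompose into vertex-disjoint cycles and vertex-disjoint paths (equivalently, every
vertex on no cycle has degree at most 2). -/
def IsCactus (H : SimpleGraph W) : Prop :=
  H.Connected ∧ Subcubic H ∧
  (∀ C₁ C₂ : H.Subgraph, IsCycleSub C₁ → IsCycleSub C₂ → C₁ ≠ C₂ →
    Disjoint C₁.verts C₂.verts) ∧
  ∀ v : W, (∀ C : H.Subgraph, IsCycleSub C → v ∉ C.verts) → (H.neighborSet v).ncard ≤ 2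

/-- A semi-cactus: connected, maximum degree at most 4, every block is a cycle or a `K₂`
(equivalently, distinct cycles are edge-disjoint), and every vertex lies in at most two
blocks (cycles through `v` together with bridges at `v` number at most 2). -/
def IsSemiCactus (H : SimpleGraph W) : Prop :=
  H.Connected ∧ (∀ v : W, (H.neighborSet v).Finite ∧ (H.neighborSet v).ncard ≤ 4) ∧
  (∀ C₁ C₂ : H.Subgraph, IsCycleSub C₁ → IsCycleSub C₂ → C₁ ≠ C₂ →
    Disjoint C₁.edgeSet C₂.edgeSet) ∧
  ∀ v : W,
    {C : H.Subgraph | IsCycleSub C ∧ v ∈ C.verts}.encard +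
      {e : Sym2 W | e ∈ H.edgeSet ∧ v ∈ e ∧
        ∀ C : H.Subgraph, IsCycleSub C → e ∉ C.edgeSet}.encard ≤ 2

/-- Every cycle of `H` is even. -/
def EvenCycles (H : SimpleGraph W) : Prop :=
  ∀ C : H.Subgraph, IsCycleSub C → Even C.verts.ncard

/-- `v` is a cut-vertex of `H`: removing `v` separates two vertices. -/
def IsCutVert (H : SimpleGraph W) (v : W) : Prop :=
  ∃ a b : W, a ≠ v ∧ b ≠ v ∧ H.Reachable a b ∧ ¬ (del H {v}).Reachable a b

/-- `H` is non-separable: connected without cut-vertices. -/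
def Nonseparable (H : SimpleGraph W) : Prop := H.Connected ∧ ∀ v : W, ¬ IsCutVert H v

/-- `B` is the vertex set of a block of `H`: a maximal set inducing a non-separable graph. -/
def IsBlockSet (H : SimpleGraph W) (B : Set W) : Prop :=
  Nonseparable (H.induce B) ∧ ∀ B' : Set W, B ⊆ B' → Nonseparable (H.induce B') → B' = B

/-- An end-block: a block containing at most one cut-vertex of `H`. -/
def IsEndBlock (H : SimpleGraph W) (B : Set W) : Prop :=
  IsBlockSet H B ∧ {v ∈ B | IsCutVert H v}.encard ≤ 1

/-- A block-chain: a connected graph whose block-cut tree is a path, i.e. every block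
contains at most two cut-vertices and every cut-vertex lies in at most two blocks. -/
def IsBlockChain (H : SimpleGraph W) : Prop :=
  H.Connected ∧
  (∀ B : Set W, IsBlockSet H B → {v ∈ B | IsCutVert H v}.encard ≤ 2) ∧
  ∀ v : W, IsCutVert H v → {B : Set W | IsBlockSet H B ∧ v ∈ B}.encard ≤ 2

/-- A block-chain connecting `u` and `v`: either `H` is non-separable, or `H` is separable
and `u`, `v` are non-cut vertices of two distinct end-blocks. -/
def BlockChainConn (H : SimpleGraph W) (u v : W) : Prop :=
  IsBlockChain H ∧
  (Nonseparable H ∨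
    ((∃ x, IsCutVert H x) ∧
      ∃ B₁ B₂ : Set W, IsEndBlock H B₁ ∧ IsEndBlock H B₂ ∧ B₁ ≠ B₂ ∧
        u ∈ B₁ ∧ v ∈ B₂ ∧ ¬ IsCutVert H u ∧ ¬ IsCutVert H v))

/-- The `k`-th power of `G`: vertices at distance at most `k` become adjacent. -/
def gpow (G : SimpleGraph V) (k : ℕ) : SimpleGraph V where
  Adj u v := u ≠ v ∧ ∃ p : G.Walk u v, p.length ≤ k
  symm := ⟨fun u v h => ⟨h.1.symm, by obtain ⟨p, hp⟩ := h.2; exact ⟨p.reverse, by simpa using hp⟩⟩⟩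
  loopless := ⟨fun v h => h.1 rfl⟩

/-- The copy `G × {d₀}` of `G` inside the Cartesian product `G □ D`. -/
def copyAt (G : SimpleGraph V) (d₀ : W) : SimpleGraph (V × W) where
  Adj p q := G.Adj p.1 q.1 ∧ p.2 = d₀ ∧ q.2 = d₀
  symm := ⟨fun p q h => ⟨h.1.symm, h.2.2, h.2.1⟩⟩
  loopless := ⟨fun p h => G.loopless.irrefl _ h.1⟩

/-- The line graph of the subgraph `F` of `G`, presented on the vertex set `E(G)` of the
line graph of `G` (edges of `G` not in `F` are isolated). -/
def lineSub (G F : SimpleGraph V) : SimpleGraph G.edgeSet where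
  Adj e f := (e : Sym2 V) ∈ F.edgeSet ∧ (f : Sym2 V) ∈ F.edgeSet ∧ e ≠ f ∧
    ∃ x : V, x ∈ (e : Sym2 V) ∧ x ∈ (f : Sym2 V)
  symm := ⟨fun e f h =>
    ⟨h.2.1, h.1, h.2.2.1.symm, by obtain ⟨x, h1, h2⟩ := h.2.2.2; exact ⟨x, h2, h1⟩⟩⟩
  loopless := ⟨fun e h => h.2.2.1 rfl⟩

/-- `B ⊆ V(G)` induces a cycle of `G`. -/
def IsCycleSet (G : SimpleGraph V) (B : Set V) : Prop :=
  B.Finite ∧ B.Nonempty ∧ (G.induce B).Connected ∧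
    ∀ v ∈ B, (G.neighborSet v ∩ B).ncard = 2

/-- The copy of `G` at `d₀` is a subgraph of the Cartesian product. -/
lemma copyAt_le_boxProd {V : Type u} {W : Type w} (G : SimpleGraph V) (D : SimpleGraph W)
    (d₀ : W) : copyAt G d₀ ≤ G.boxProd D := by
  intro _ _ h
  exact boxProd_adj.2 (Or.inl ⟨h.1, h.2.1.trans h.2.2.symm⟩)

lemma del_mono {V : Type u} {F G : SimpleGraph V} (h : F ≤ G) (S : Set V) :
    del F S ≤ del G S :=
  fun _ _ hab => ⟨h hab.1, hab.2⟩

lemma RayEquiv.mono {V : Type u} {F G : SimpleGraph V} (h : F ≤ G) {R₁ R₂ : ℕ → V}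
    (hR : RayEquiv F R₁ R₂) : RayEquiv G R₁ R₂ := by
  intro S hS
  obtain ⟨m, n, hm, hn, hr⟩ := hR S hS
  exact ⟨m, n, hm, hn, hr.mono (del_mono h S)⟩

/-- A map sending each edge to a pair of mutually reachable vertices preserves reachability. -/
lemma reachable_map_of_adj {V : Type u} {W : Type w} {G : SimpleGraph V} {H : SimpleGraph W}
    (f : V → W) (hf : ∀ a b, G.Adj a b → H.Reachable (f a) (f b)) {a b : V}
    (h : G.Reachable a b) : H.Reachable (f a) (f b) := by
  obtain ⟨p⟩ := h
  induction p with
  | nil => exact Reachable.refl _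
  | cons hadj _ ih => exact (hf _ _ hadj).trans ih

/-- The retraction of the product onto the copy of `G` preserves reachability outside
a union of fibres. -/
lemma reachable_del_copyAt {V : Type u} {W : Type w} {G : SimpleGraph V} {D : SimpleGraph W}
    (d₀ : W) {S : Set (V × W)} {p q : V × W}
    (h : (del (G.boxProd D) (Prod.fst ⁻¹' (Prod.fst '' S))).Reachable p q) :
    (del (copyAt G d₀) S).Reachable (p.1, d₀) (q.1, d₀) := by
  refine reachable_map_of_adj (fun x : V × W => (x.1, d₀)) (fun a b hab => ?_) h
  obtain ⟨hadj, ha, hb⟩ := hab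
  rcases boxProd_adj.1 hadj with h1 | h1
  · exact Adj.reachable ⟨⟨h1.1, rfl, rfl⟩, fun hS => ha ⟨_, hS, rfl⟩, fun hS => hb ⟨_, hS, rfl⟩⟩
  · simp only [h1.2]
    exact Reachable.refl _

/-- Any two vertices of a fibre over a vertex outside the projection of `S` are connected
outside `S`. -/
lemma reachable_del_fibre {V : Type u} {W : Type w} (G : SimpleGraph V) {D : SimpleGraph W}
    (hD : D.Connected) {S : Set (V × W)} {v : V} (hv : v ∉ Prod.fst '' S) (a b : W) :
    (del (G.boxProd D) S).Reachable (v, a) (v, b) := by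
  refine reachable_map_of_adj (fun x : W => (v, x)) (fun x y hxy => ?_) (hD.preconnected a b)
  exact Adj.reachable ⟨boxProd_adj.2 (Or.inr ⟨hxy, rfl⟩), fun hS => hv ⟨_, hS, rfl⟩,
    fun hS => hv ⟨_, hS, rfl⟩⟩

lemma finite_preimage_fst_image {V : Type u} {W : Type w} [Finite W] {S : Set (V × W)}
    (hS : S.Finite) : (Prod.fst ⁻¹' (Prod.fst '' S) : Set (V × W)).Finite := by
  rw [← Set.prod_univ]
  exact (hS.image _).prod Set.finite_univ

lemma rayEquiv_copyAt_of_boxProd {V : Type u} {W : Type w} [Finite W] {G : SimpleGraph V}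
    {D : SimpleGraph W} {d₀ : W} {R₁ R₂ : ℕ → V × W} (h₁ : IsRay (copyAt G d₀) R₁)
    (h₂ : IsRay (copyAt G d₀) R₂) (h : RayEquiv (G.boxProd D) R₁ R₂) :
    RayEquiv (copyAt G d₀) R₁ R₂ := by
  intro S hS
  obtain ⟨m, n, hm, hn, hr⟩ := h _ (finite_preimage_fst_image hS)
  refine ⟨m, n, fun i hi hi' => hm i hi ⟨_, hi', rfl⟩, fun j hj hj' => hn j hj ⟨_, hj', rfl⟩, ?_⟩
  have e₁ : ((R₁ m).1, d₀) = R₁ m := Prod.ext rfl (h₁.2 m).2.1.symm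
  have e₂ : ((R₂ n).1, d₀) = R₂ n := Prod.ext rfl (h₂.2 n).2.1.symm
  simpa only [e₁, e₂] using reachable_del_copyAt d₀ hr

/-- A sequence in which each value occurs finitely often admits a subsequence `t` of last
visits, each starting with the successor of the previous one. -/
lemma exists_last_visits {V : Type u} (x : ℕ → V) (hx : ∀ v, {n | x n = v}.Finite) :
    ∃ t : ℕ → ℕ, StrictMono t ∧ (∀ k m, x m = x (t k) → m ≤ t k) ∧
      ∀ k, x (t (k + 1)) = x (t k + 1) := by
  have hlast : ∀ n, ∃ l, x l = x n ∧ ∀ m, x m = x n → m ≤ l := fun n => by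
    obtain ⟨l, hl, hmax⟩ := Set.exists_max_image {m | x m = x n} id (hx _) ⟨n, rfl⟩
    exact ⟨l, hl, hmax⟩
  choose last hlast_eq hlast_max using hlast
  let t : ℕ → ℕ := fun k => Nat.rec (last 0) (fun _ l => last (l + 1)) k
  refine ⟨t, strictMono_nat_of_lt_succ fun k => hlast_max (t k + 1) (t k + 1) rfl, ?_,
    fun k => hlast_eq (t k + 1)⟩
  intro k m hm
  cases k with
  | zero => exact hlast_max 0 m (hm.trans (hlast_eq 0))
  | succ k => exact hlast_max (t k + 1) m (hm.trans (hlast_eq (t k + 1)))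

/-- Every ray of the product is equivalent to a ray of the copy of `G`. -/
lemma exists_ray_copyAt_rayEquiv {V : Type u} {W : Type w} [Finite W] {G : SimpleGraph V}
    {D : SimpleGraph W} (hD : D.Connected) (d₀ : W) {R : ℕ → V × W}
    (hR : IsRay (G.boxProd D) R) :
    ∃ R', IsRay (copyAt G d₀) R' ∧ RayEquiv (G.boxProd D) R R' := by
  have hfin : ∀ v, {n | (R n).1 = v}.Finite := fun v => by
    refine ((Set.finite_singleton v).prod (Set.finite_univ (α := W))).preimage
      hR.1.injOn |>.subset fun n hn => ?_
    exact ⟨hn, trivial⟩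
  obtain ⟨t, ht, hmax, hsucc⟩ := exists_last_visits (fun n => (R n).1) hfin
  refine ⟨fun k => ((R (t k)).1, d₀), ⟨fun i j hij => ?_, fun k => ⟨?_, rfl, rfl⟩⟩, ?_⟩
  · have h : (R (t i)).1 = (R (t j)).1 := (Prod.ext_iff.1 hij).1
    exact ht.injective (le_antisymm (hmax j _ h) (hmax i _ h.symm))
  · have h := hsucc k
    simp only at h ⊢
    rw [h]
    rcases boxProd_adj.1 (hR.2 (t k)) with h1 | h1
    · exact h1.1
    · exact absurd (hmax k _ h1.2.symm) (by omega)
  · intro S hS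
    obtain ⟨N, hN⟩ := ((finite_preimage_fst_image hS).preimage hR.1.injOn).bddAbove
    have hout : ∀ i, N < i → (R i).1 ∉ Prod.fst '' S := fun i hi h => absurd (hN h) (by omega)
    have htN : ∀ k, N < k → N < t k := fun k hk => hk.trans_le (ht.id_le k)
    refine ⟨t (N + 1), N + 1, fun i hi h => ?_, fun j hj h => ?_, ?_⟩
    · exact hout i ((htN _ (by omega)).trans_le hi) ⟨_, h, rfl⟩
    · exact hout (t j) (htN j (by omega)) ⟨_, h, rfl⟩
    · exact reachable_del_fibre G hD (hout _ (htN _ (by omega))) _ d₀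

/-- For `G` infinite locally finite connected and `D` finite connected,
the copy `G × {d₀}` of `G` is a faithful subgraph of the Cartesian product `G □ D`. -/
theorem copy_faithful_boxProd {V : Type u} {W : Type w} (G : SimpleGraph V)
    (hinf : Infinite V) (hlf : LocFin G) (hconn : G.Connected)
    (D : SimpleGraph W) (hWfin : Finite W) (hDconn : D.Connected) (d₀ : W) :
    copyAt G d₀ ≤ G.boxProd D ∧ Faithful (copyAt G d₀) (G.boxProd D) := by
  have hle := copyAt_le_boxProd G D d₀
  exact ⟨hle, fun _ hR => exists_ray_copyAt_rayEquiv hDconn d₀ hR,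
    fun _ _ h₁ h₂ => ⟨RayEquiv.mono hle, rayEquiv_copyAt_of_boxProd h₁ h₂⟩⟩

end IGraph
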